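/- arXiv:gr-qc/0203018 — 3 statements merged into one kernel-verified Lean document; each statement's English description precedes it below -/
import Mathlib

section
/- Let u, v, w be unit vectors in a real inner product space such that angle(u,v) + angle(v,w) + angle(w,u) = 2π. Then u, v, w are linearly dependent (i.e. the corresponding three points of the sphere lie on a single great circle, so the geodesic triangle they span is degenerate). -/
open Real InnerProductGeometry

/-- If the pairwise angles of three unit vectors sum to exactly `2π`,
then the vectors are linearly dependent (the corresponding points of the sphere
lie on a single great circle, so the geodesic triangle is degenerate). -/
theorem linearDependent_of_angle_sum_eq_two_pi
    {V : Type*} [NormedAddCommGroup V] [InnerProductSpace ℝ V]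
    (u v w : V) (hu : ‖u‖ = 1) (hv : ‖v‖ = 1) (hw : ‖w‖ = 1)
    (h : angle u v + angle v w + angle w u = 2 * π) :
    ¬ LinearIndependent ℝ ![u, v, w] := by
  intro hli
  have huv : inner ℝ u v = cos (angle u v) := by
    rw [← cos_angle_mul_norm_mul_norm, hu, hv]; ring
  have hvw : inner ℝ v w = cos (angle v w) := by
    rw [← cos_angle_mul_norm_mul_norm, hv, hw]; ring
  have hwu : inner ℝ w u = cos (angle w u) := by
    rw [← cos_angle_mul_norm_mul_norm, hw, hu]; ring
  have huu : inner ℝ u u = (1 : ℝ) := by rw [real_inner_self_eq_norm_sq, hu]; norm_num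
  have hvv : inner ℝ v v = (1 : ℝ) := by rw [real_inner_self_eq_norm_sq, hv]; norm_num
  have hww : inner ℝ w w = (1 : ℝ) := by rw [real_inner_self_eq_norm_sq, hw]; norm_num
  have hvu := real_inner_comm u v
  have hwv := real_inner_comm v w
  have huw := real_inner_comm w u
  generalize angle u v = a at *
  generalize angle v w = b at *
  have hc : angle w u = 2 * π - (a + b) := by linarith
  rw [hc] at hwu
  have hcc : cos (2 * π - (a + b)) = cos a * cos b - sin a * sin b := by
    rw [cos_two_pi_sub, cos_add]
  rw [hcc] at hwu
  have h1 := sin_sq_add_cos_sq a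
  have h2 := sin_sq_add_cos_sq b
  have key : sin b • u + (-(sin a * cos b + cos a * sin b)) • v + sin a • w = 0 := by
    rw [← inner_self_eq_zero (𝕜 := ℝ)]
    simp only [inner_add_left, inner_add_right, real_inner_smul_left, real_inner_smul_right,
      huu, hvv, hww, hvu, hwv, huw, huv, hvw, hwu]
    generalize sin a = x at *
    generalize sin b = y at *
    generalize cos a = z at *
    generalize cos b = t at *
    grind
  rw [Fintype.linearIndependent_iff] at hli
  have hs : sin a = 0 := by
    have := hli ![sin b, -(sin a * cos b + cos a * sin b), sin a]
      (by simpa [Fin.sum_univ_three] using key) 2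
    simpa using this
  have key2 : u - cos a • v = 0 := by
    rw [← inner_self_eq_zero (𝕜 := ℝ)]
    simp only [inner_sub_left, inner_sub_right, real_inner_smul_left, real_inner_smul_right,
      huu, hvv, hvu, huv]
    rw [hs] at h1
    linarith
  have := hli ![1, -cos a, 0]
      (by simpa [Fin.sum_univ_three, sub_eq_add_neg] using key2) 0
  simp at this
end

section
/- Let α, β, γ ∈ [0,π] satisfy the strict inequalities α < β + γ, β < γ + α, γ < α + β and α + β + γ < 2π. Then there exist unit vectors u, v, w in ℝ³ (Euclidean 3-space) which are linearly independent and satisfy angle(v,w) = α, angle(w,u) = β, angle(u,v) = γ. -/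
open Real InnerProductGeometry

/-- Realization of a non-degenerate spherical triangle: if
`α, β, γ ∈ [0, π]` satisfy the strict triangle inequalities and `α + β + γ < 2π`,
then there are linearly independent unit vectors in `ℝ³` realizing these angles. -/
theorem exists_unit_vectors_of_strict_triangle_inequalities
    (α β γ : ℝ) (hα : α ∈ Set.Icc 0 π) (hβ : β ∈ Set.Icc 0 π) (hγ : γ ∈ Set.Icc 0 π)
    (h1 : α < β + γ) (h2 : β < γ + α) (h3 : γ < α + β) (h4 : α + β + γ < 2 * π) :
    ∃ u v w : EuclideanSpace ℝ (Fin 3), ‖u‖ = 1 ∧ ‖v‖ = 1 ∧ ‖w‖ = 1 ∧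
      LinearIndependent ℝ ![u, v, w] ∧
      angle v w = α ∧ angle w u = β ∧ angle u v = γ := by
  obtain ⟨ha0, ha1⟩ := hα
  obtain ⟨hb0, hb1⟩ := hβ
  obtain ⟨hc0, hc1⟩ := hγ
  have hs : 0 < sin γ := sin_pos_of_pos_of_lt_pi (by linarith) (by linarith)
  have hA : cos α < cos (β - γ) := by
    rw [← cos_abs (β - γ)]
    exact cos_lt_cos_of_nonneg_of_le_pi (abs_nonneg _) ha1
      (abs_lt.2 ⟨by linarith, by linarith⟩)
  have hB : cos (β + γ) < cos α := by
    rcases le_total (β + γ) π with h | h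
    · exact cos_lt_cos_of_nonneg_of_le_pi ha0 h h1
    · rw [← cos_two_pi_sub (β + γ)]
      exact cos_lt_cos_of_nonneg_of_le_pi ha0 (by linarith) (by linarith)
  rw [cos_sub] at hA
  rw [cos_add] at hB
  obtain ⟨y, hy⟩ : ∃ y, y * sin γ = cos α - cos β * cos γ :=
    ⟨(cos α - cos β * cos γ) / sin γ, by field_simp⟩
  have hy1 : y < sin β := by
    by_contra hh
    have := mul_le_mul_of_nonneg_right (not_lt.1 hh) hs.le
    linarith
  have hy2 : -sin β < y := by
    by_contra hh
    have := mul_le_mul_of_nonneg_right (not_lt.1 hh) hs.le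
    linarith
  have hz : 0 < sin β ^ 2 - y ^ 2 := by nlinarith
  obtain ⟨z, hz0, hzz⟩ : ∃ z : ℝ, 0 < z ∧ z ^ 2 = sin β ^ 2 - y ^ 2 :=
    ⟨√(sin β ^ 2 - y ^ 2), sqrt_pos.2 hz, sq_sqrt hz.le⟩
  have hu : ‖(!₂[1, 0, 0] : EuclideanSpace ℝ (Fin 3))‖ = 1 := by
    simp [EuclideanSpace.norm_eq, Fin.sum_univ_three]
  have hv : ‖(!₂[cos γ, sin γ, 0] : EuclideanSpace ℝ (Fin 3))‖ = 1 := by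
    simp [EuclideanSpace.norm_eq, Fin.sum_univ_three]
  have hw : ‖(!₂[cos β, y, z] : EuclideanSpace ℝ (Fin 3))‖ = 1 := by
    simp [EuclideanSpace.norm_eq, Fin.sum_univ_three, hzz]
  refine ⟨!₂[1, 0, 0], !₂[cos γ, sin γ, 0], !₂[cos β, y, z], hu, hv, hw, ?_, ?_, ?_, ?_⟩
  · rw [Fintype.linearIndependent_iff]
    intro g hg
    have e0 := congrArg (fun x : EuclideanSpace ℝ (Fin 3) => x 0) hg
    have e1 := congrArg (fun x : EuclideanSpace ℝ (Fin 3) => x 1) hg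
    have e2 := congrArg (fun x : EuclideanSpace ℝ (Fin 3) => x 2) hg
    simp [Fin.sum_univ_three] at e0 e1 e2
    have g2 : g 2 = 0 := e2.resolve_right hz0.ne'
    have g1 : g 1 = 0 := by simpa [g2, hs.ne'] using e1
    have g0 : g 0 = 0 := by simpa [g2, g1] using e0
    intro i
    fin_cases i <;> assumption
  · rw [angle, hv, hw, ← arccos_cos ha0 ha1]
    congr 1
    simp [PiLp.inner_apply, Fin.sum_univ_three]
    linarith
  · rw [angle, hw, hu]
    refine Eq.trans ?_ (arccos_cos hb0 hb1)
    congr 1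
    simp [PiLp.inner_apply, Fin.sum_univ_three]
  · rw [angle, hu, hv]
    refine Eq.trans ?_ (arccos_cos hc0 hc1)
    congr 1
    simp [PiLp.inner_apply, Fin.sum_univ_three]
end

section
/- Let r ≥ 3 be an integer and let i, j, k be nonnegative half-integers with i + j + k ∈ ℤ. Then the admissibility conditions i ≤ j + k, j ≤ k + i, k ≤ i + j, i + j + k ≤ r − 2 hold if and only if there exist linearly independent unit vectors u, v, w in ℝ⁴ with angle(v,w) = (2π/r)(i + 1/2), angle(w,u) = (2π/r)(j + 1/2), angle(u,v) = (2π/r)(k + 1/2); that is, if and only if the lengths i + 1/2, j + 1/2, k + 1/2 are the side lengths of a non-degenerate geodesic triangle on the 3-sphere of radius r/(2π). -/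
open Real InnerProductGeometry

lemma aux_cos {A B C : ℝ} (hA : 0 ≤ A) (hA' : A ≤ π) (hB : 0 ≤ B) (hB' : B ≤ π)
    (hC : 0 ≤ C) (hC' : C ≤ π)
    (h : (cos A - cos B * cos C)^2 < (1 - cos B^2) * (1 - cos C^2)) :
    A < B + C ∧ B < C + A ∧ C < A + B ∧ A + B + C < 2 * π := by
  have hB2 := sin_sq_add_cos_sq B
  have hC2 := sin_sq_add_cos_sq C
  have hsB := sin_nonneg_of_nonneg_of_le_pi hB hB'
  have hsC := sin_nonneg_of_nonneg_of_le_pi hC hC'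
  have h' : (cos A - cos B * cos C)^2 < (sin B * sin C)^2 := by
    rw [mul_pow]
    rw [show sin B ^ 2 = 1 - cos B ^2 by linarith, show sin C ^ 2 = 1 - cos C ^2 by linarith]
    exact h
  have h2 := abs_lt_of_sq_lt_sq' h' (mul_nonneg hsB hsC)
  have e1 : cos (B + C) < cos A := by rw [cos_add]; linarith [h2.1]
  have e2 : cos A < cos (B - C) := by rw [cos_sub]; linarith [h2.2]
  have e3 : A < B + C := by
    by_contra hc
    push Not at hc
    exact absurd (cos_le_cos_of_nonneg_of_le_pi (by linarith) hA' hc) (not_le.2 e1)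
  have e4 : A + B + C < 2 * π := by
    by_contra hc
    push Not at hc
    have := cos_le_cos_of_nonneg_of_le_pi (x := 2 * π - (B + C)) (y := A)
      (by linarith) hA' (by linarith)
    rw [cos_two_pi_sub] at this
    linarith
  refine ⟨e3, ?_, ?_, e4⟩
  · by_contra hc
    push Not at hc
    exact absurd (cos_le_cos_of_nonneg_of_le_pi hA (by linarith) (show A ≤ B - C by linarith))
      (not_le.2 e2)
  · by_contra hc
    push Not at hc
    have e5 : cos A < cos (C - B) := by rw [← cos_neg (C - B), neg_sub]; exact e2
    exact absurd (cos_le_cos_of_nonneg_of_le_pi hA (by linarith) (show A ≤ C - B by linarith))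
      (not_le.2 e5)

lemma aux_cos' {A B C : ℝ} (hA : 0 < A) (hB : 0 < B) (hC : 0 < C)
    (h1 : A < B + C) (h2 : B < C + A) (h3 : C < A + B) (h4 : A + B + C < 2 * π) :
    (cos A - cos B * cos C)^2 < (1 - cos B^2) * (1 - cos C^2) := by
  have hB2 := sin_sq_add_cos_sq B
  have hC2 := sin_sq_add_cos_sq C
  have e1 : cos (B + C) < cos A := by
    rcases le_total (B + C) π with h | h
    · exact cos_lt_cos_of_nonneg_of_le_pi hA.le h h1
    · rw [← cos_two_pi_sub]
      exact cos_lt_cos_of_nonneg_of_le_pi hA.le (by linarith) (by linarith)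
  have e2 : cos A < cos (B - C) := by
    rw [← cos_abs (B - C)]
    apply cos_lt_cos_of_nonneg_of_le_pi (abs_nonneg _) (by linarith)
    rw [abs_lt]; constructor <;> linarith
  rw [cos_add] at e1
  rw [cos_sub] at e2
  rw [show 1 - cos B ^2 = sin B ^ 2 by linarith, show 1 - cos C ^2 = sin C ^ 2 by linarith,
    ← mul_pow]
  apply sq_lt_sq'
  · linarith
  · linarith

lemma aux_back (u v w : EuclideanSpace ℝ (Fin 4)) (hu : ‖u‖ = 1) (hv : ‖v‖ = 1) (hw : ‖w‖ = 1)
    (hl : LinearIndependent ℝ ![u, v, w]) :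
    (cos (angle v w) - cos (angle w u) * cos (angle u v))^2
      < (1 - cos (angle w u)^2) * (1 - cos (angle u v)^2) := by
  have ea : cos (angle v w) = inner ℝ v w := by rw [cos_angle, hv, hw]; simp
  have eb : cos (angle w u) = inner ℝ w u := by rw [cos_angle, hu, hw]; simp
  have ec : cos (angle u v) = inner ℝ u v := by rw [cos_angle, hv, hu]; simp
  rw [ea, eb, ec]
  have huu : inner ℝ u u = (1:ℝ) := by rw [real_inner_self_eq_norm_sq, hu]; norm_num
  have hvv : inner ℝ v v = (1:ℝ) := by rw [real_inner_self_eq_norm_sq, hv]; norm_num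
  have hww : inner ℝ w w = (1:ℝ) := by rw [real_inner_self_eq_norm_sq, hw]; norm_num
  have hvu := real_inner_comm u v
  have hwv := real_inner_comm v w
  have huw := real_inner_comm w u
  set a : ℝ := inner ℝ v w
  set b : ℝ := inner ℝ w u
  set c : ℝ := inner ℝ u v
  have key : ∀ x y z : ℝ, x • u + y • v + z • w = 0 → x = 0 ∧ y = 0 ∧ z = 0 := by
    intro x y z h
    have := Fintype.linearIndependent_iff.1 hl ![x, y, z] (by simpa [Fin.sum_univ_three] using h)
    exact ⟨this 0, this 1, this 2⟩
  have nrm : ∀ x y z : ℝ, (x, y, z) ≠ 0 →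
      0 < x^2 + y^2 + z^2 + 2 * (y * z * a) + 2 * (z * x * b) + 2 * (x * y * c) := by
    intro x y z hne
    have hp : x • u + y • v + z • w ≠ 0 := by
      intro h
      obtain ⟨rfl, rfl, rfl⟩ := key x y z h
      exact hne rfl
    have := real_inner_self_pos.2 hp
    simp only [inner_add_left, inner_add_right, real_inner_smul_left, real_inner_smul_right,
      huu, hvv, hww, hvu, hwv, huw] at this
    change 0 < _ at this
    nlinarith [this]
  have hc : 0 < 1 - c^2 := by
    have := nrm (-c) 1 0 (by simp)
    nlinarith
  have hd := nrm (-(1 - c^2) * b + (a - b * c) * c) (-(a - b * c)) (1 - c^2)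
    (by intro h; simp only [Prod.mk_eq_zero] at h; linarith [h.2.2])
  have : 0 < (1 - c^2) * ((1 - b^2) * (1 - c^2) - (a - b * c)^2) := by
    convert hd using 1; ring
  have := (pos_iff_pos_of_mul_pos this).1 hc
  linarith

lemma aux_fwd {A B C : ℝ} (hA : 0 < A) (hB : 0 < B) (hC : 0 < C)
    (h1 : A < B + C) (h2 : B < C + A) (h3 : C < A + B) (h4 : A + B + C < 2 * π) :
    ∃ u v w : EuclideanSpace ℝ (Fin 4), ‖u‖ = 1 ∧ ‖v‖ = 1 ∧ ‖w‖ = 1 ∧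
        LinearIndependent ℝ ![u, v, w] ∧ angle v w = A ∧ angle w u = B ∧ angle u v = C := by
  have hd := aux_cos' hA hB hC h1 h2 h3 h4
  have hC2 := sin_sq_add_cos_sq C
  have hs : 0 < sin C := sin_pos_of_pos_of_lt_pi hC (by linarith)
  set s := sin C
  obtain ⟨y, hy⟩ : ∃ y, y * s = cos A - cos B * cos C := ⟨(cos A - cos B * cos C) / s, by field_simp⟩
  have hz : 0 < 1 - cos B ^ 2 - y ^ 2 := by
    rw [← hy, show 1 - cos C^2 = s^2 by linarith] at hd
    have : 0 < s^2 * (1 - cos B ^ 2 - y ^ 2) := by nlinarith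
    exact (pos_iff_pos_of_mul_pos this).1 (by positivity)
  obtain ⟨z, hz0, hz2⟩ : ∃ z, 0 < z ∧ z ^ 2 = 1 - cos B ^ 2 - y ^ 2 :=
    ⟨√(1 - cos B ^ 2 - y ^ 2), sqrt_pos.2 hz, sq_sqrt hz.le⟩
  have nu : ‖(!₂[1, 0, 0, 0] : EuclideanSpace ℝ (Fin 4))‖ = 1 := by
    rw [EuclideanSpace.norm_eq, sqrt_eq_one]; simp [Fin.sum_univ_four]
  have nv : ‖(!₂[cos C, s, 0, 0] : EuclideanSpace ℝ (Fin 4))‖ = 1 := by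
    rw [EuclideanSpace.norm_eq, sqrt_eq_one]; simp [Fin.sum_univ_four]; linarith
  have nw : ‖(!₂[cos B, y, z, 0] : EuclideanSpace ℝ (Fin 4))‖ = 1 := by
    rw [EuclideanSpace.norm_eq, sqrt_eq_one]; simp [Fin.sum_univ_four]; linarith
  refine ⟨!₂[1, 0, 0, 0], !₂[cos C, s, 0, 0], !₂[cos B, y, z, 0], nu, nv, nw, ?_, ?_, ?_, ?_⟩
  · rw [Fintype.linearIndependent_iff]
    intro g hg
    have g0 := congrArg (fun x : EuclideanSpace ℝ (Fin 4) => x 0) hg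
    have g1 := congrArg (fun x : EuclideanSpace ℝ (Fin 4) => x 1) hg
    have g2 := congrArg (fun x : EuclideanSpace ℝ (Fin 4) => x 2) hg
    simp [Fin.sum_univ_three] at g0 g1 g2
    have k2 : g 2 = 0 := g2.resolve_right hz0.ne'
    have k1 : g 1 = 0 := by
      rw [k2] at g1; simpa [hs.ne'] using g1
    have k0 : g 0 = 0 := by
      rw [k2, k1] at g0; simpa using g0
    intro t; fin_cases t <;> assumption
  · unfold angle
    rw [nv, nw, ← arccos_cos hA.le (by linarith)]
    congr 1
    simp [PiLp.inner_apply, Fin.sum_univ_four]; linarith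
  · unfold angle
    rw [nu, nw]; refine Eq.trans ?_ (arccos_cos hB.le (by linarith))
    congr 1
    simp [PiLp.inner_apply, Fin.sum_univ_four]
  · unfold angle
    rw [nv, nu]; refine Eq.trans ?_ (arccos_cos hC.le (by linarith))
    congr 1
    simp [PiLp.inner_apply, Fin.sum_univ_four]

lemma aux_int {x y : ℝ} (h : ∃ m : ℤ, (m : ℝ) = y - x) (hl : x < y + 1) : x ≤ y := by
  obtain ⟨m, hm⟩ := h
  have : (-1 : ℝ) < m := by linarith
  have : (-1 : ℤ) < m := by exact_mod_cast this
  have : (0 : ℝ) ≤ m := by exact_mod_cast (by omega : 0 ≤ m)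
  linarith

/-- For an integer `r ≥ 3` and nonnegative half-integers `i, j, k`
with `i + j + k ∈ ℤ`, the admissibility conditions hold iff the lengths
`i+1/2`, `j+1/2`, `k+1/2` are the side lengths of a non-degenerate geodesic
triangle on the 3-sphere of radius `r/(2π)`, i.e. iff there exist linearly
independent unit vectors in `ℝ⁴` with the corresponding pairwise angles. -/
theorem admissible_iff_exists_nondegenerate_spherical_triangle
    (r : ℤ) (hr : 3 ≤ r) (i j k : ℝ)
    (hi : ∃ n : ℕ, (n : ℝ) = 2 * i) (hj : ∃ n : ℕ, (n : ℝ) = 2 * j)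
    (hk : ∃ n : ℕ, (n : ℝ) = 2 * k) (hsum : ∃ m : ℤ, (m : ℝ) = i + j + k) :
    (i ≤ j + k ∧ j ≤ k + i ∧ k ≤ i + j ∧ i + j + k ≤ (r : ℝ) - 2) ↔
      ∃ u v w : EuclideanSpace ℝ (Fin 4), ‖u‖ = 1 ∧ ‖v‖ = 1 ∧ ‖w‖ = 1 ∧
        LinearIndependent ℝ ![u, v, w] ∧
        angle v w = (2 * π / r) * (i + 1 / 2) ∧
        angle w u = (2 * π / r) * (j + 1 / 2) ∧
        angle u v = (2 * π / r) * (k + 1 / 2) := by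
  obtain ⟨a, ha⟩ := hi
  obtain ⟨b, hb⟩ := hj
  obtain ⟨c, hc⟩ := hk
  obtain ⟨m, hm⟩ := hsum
  have ha0 : (0:ℝ) ≤ a := a.cast_nonneg
  have hb0 : (0:ℝ) ≤ b := b.cast_nonneg
  have hc0 : (0:ℝ) ≤ c := c.cast_nonneg
  have hr0 : (0:ℝ) < r := by exact_mod_cast (by omega : 0 < r)
  have ht : 0 < 2 * π / r := by positivity
  have htr : 2 * π / r * r = 2 * π := by field_simp
  set t := 2 * π / r
  constructor
  · rintro ⟨h1, h2, h3, h4⟩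
    apply aux_fwd
    · exact mul_pos ht (by linarith)
    · exact mul_pos ht (by linarith)
    · exact mul_pos ht (by linarith)
    · rw [← mul_add]; exact mul_lt_mul_of_pos_left (by linarith) ht
    · rw [← mul_add]; exact mul_lt_mul_of_pos_left (by linarith) ht
    · rw [← mul_add]; exact mul_lt_mul_of_pos_left (by linarith) ht
    · rw [← mul_add, ← mul_add, ← htr]; exact mul_lt_mul_of_pos_left (by linarith) ht
  · rintro ⟨u, v, w, hu, hv, hw, hl, hA, hB, hC⟩
    obtain ⟨h1, h2, h3, h4⟩ := aux_cos (angle_nonneg v w) (angle_le_pi v w) (angle_nonneg w u)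
      (angle_le_pi w u) (angle_nonneg u v) (angle_le_pi u v) (aux_back u v w hu hv hw hl)
    rw [hA, hB, hC, ← mul_add] at h1 h2 h3 h4
    rw [← mul_add, ← htr] at h4
    have h1 := lt_of_mul_lt_mul_left h1 ht.le
    have h2 := lt_of_mul_lt_mul_left h2 ht.le
    have h3 := lt_of_mul_lt_mul_left h3 ht.le
    have h4 := lt_of_mul_lt_mul_left h4 ht.le
    refine ⟨aux_int ⟨m - a, ?_⟩ ?_, aux_int ⟨m - b, ?_⟩ ?_, aux_int ⟨m - c, ?_⟩ ?_,
      aux_int ⟨r - 2 - m, ?_⟩ ?_⟩ <;> (try push_cast) <;> linarith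
end
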